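/- There exist finite connected simple graphs G and G′, each with 7 vertices and 13 edges (hence of genus g = |E| − |V| + 1 = 7), such that Jac(G) and Jac(G′) are both isomorphic to the cyclic group ℤ/545ℤ, G and G′ have the same two-variable zeta function (for every pair of integers (d, r), the number of divisor classes of degree d and Baker–Norine rank r on G equals that number on G′), and yet T_G ≠ T_{G′} as polynomials. -/

import Mathlib

open scoped Classical

namespace BNGraph

variable {V : Type} [Fintype V]

/-- The degree of a divisor `D : V → ℤ`: the sum of its values. -/
def degSum (D : V → ℤ) : ℤ := ∑ v, D v

/-- A divisor is effective if all its values are nonnegative. -/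
def Effective (D : V → ℤ) : Prop := ∀ v, 0 ≤ D v

/-- The combinatorial Laplacian of a graph, as a homomorphism on divisors. -/
noncomputable def lap (G : SimpleGraph V) : (V → ℤ) →+ (V → ℤ) where
  toFun f := fun v => (G.degree v : ℤ) * f v - ∑ w ∈ G.neighborFinset v, f w
  map_zero' := by
    funext v; simp
  map_add' f g := by
    funext v
    simp only [Pi.add_apply, Finset.sum_add_distrib]
    ring

/-- The subgroup of principal divisors: the image of the Laplacian. -/
noncomputable def Principal (G : SimpleGraph V) : AddSubgroup (V → ℤ) := (lap G).range

/-- Linear equivalence of divisors. -/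
def LinEquiv (G : SimpleGraph V) (D D' : V → ℤ) : Prop := D - D' ∈ Principal G

/-- A divisor is winnable if it is linearly equivalent to an effective divisor. -/
def Winnable (G : SimpleGraph V) (D : V → ℤ) : Prop :=
  ∃ E : V → ℤ, Effective E ∧ LinEquiv G D E

/-- The Baker–Norine rank of a divisor: the largest `r ≥ 0` such that `D - E` is
winnable for every effective divisor `E` of degree `r`, or `-1` if there is no such `r`
(equivalently, if `D` itself is not winnable). -/
noncomputable def bnRank (G : SimpleGraph V) (D : V → ℤ) : ℤ :=
  sSup {r : ℤ | r = -1 ∨ (0 ≤ r ∧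
    ∀ E : V → ℤ, Effective E → degSum E = r → Winnable G (D - E))}

/-- The Picard group of a graph: divisors modulo principal divisors. -/
abbrev Pic (G : SimpleGraph V) : Type _ := (V → ℤ) ⧸ Principal G

/-- The number of divisor classes of degree `d` and Baker–Norine rank `r`. -/
noncomputable def numClasses (G : SimpleGraph V) (d r : ℤ) : ℕ :=
  Set.ncard {c : Pic G | ∃ D : V → ℤ,
    QuotientAddGroup.mk' (Principal G) D = c ∧ degSum D = d ∧ bnRank G D = r}

/-- Two graphs have the same two-variable zeta function iff for every degree `d` and
rank `r` they have the same number of divisor classes of degree `d` and rank `r`. -/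
def SameZeta {W : Type} [Fintype W] (G : SimpleGraph V) (G' : SimpleGraph W) : Prop :=
  ∀ d r : ℤ, numClasses G d r = numClasses G' d r

/-- Degree as a homomorphism on divisors. -/
def degHom : (V → ℤ) →+ ℤ where
  toFun := degSum
  map_zero' := by simp [degSum]
  map_add' f g := by simp [degSum, Finset.sum_add_distrib]

/-- The subgroup of divisors of degree zero. -/
def Deg0 (V : Type) [Fintype V] : AddSubgroup (V → ℤ) := (degHom (V := V)).ker

/-- The Jacobian of a graph: divisor classes of degree zero. -/
noncomputable abbrev Jac (G : SimpleGraph V) : Type _ :=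
  Deg0 V ⧸ ((Principal G).addSubgroupOf (Deg0 V))

/-- The number of connected components of the spanning subgraph with edge set `A`. -/
noncomputable def numComponents (V : Type) [Fintype V] (A : Set (Sym2 V)) : ℕ :=
  Nat.card (SimpleGraph.fromEdgeSet A).ConnectedComponent

/-- The number of edges of a graph. -/
noncomputable def edgeCount (G : SimpleGraph V) : ℕ := Nat.card G.edgeSet

open MvPolynomial in
/-- The Tutte polynomial of `G`, as a polynomial in `ℤ[x, y]` with `x = X 0`, `y = X 1`:
`T_G(x,y) = Σ_{A ⊆ E(G)} (x−1)^(c(A)−c(E(G))) (y−1)^(c(A)+|A|−|V(G)|)`. -/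
noncomputable def tutte (G : SimpleGraph V) : MvPolynomial (Fin 2) ℤ :=
  ∑ A ∈ G.edgeFinset.powerset,
    (X 0 - 1) ^ (numComponents V ↑A - numComponents V G.edgeSet) *
    (X 1 - 1) ^ (numComponents V ↑A + A.card - Fintype.card V)


/-- The class of a divisor in `ZMod 545`, given the classes of the vertices. -/
def phi (a : Fin 7 → ℕ) : (Fin 7 → ℤ) →+ ZMod 545 where
  toFun D := ∑ v, (D v : ZMod 545) * (a v : ZMod 545)
  map_zero' := by simp
  map_add' f g := by simp [add_mul, Finset.sum_add_distrib]

/-- The vertex classes `a` present the Picard group of `G` as `ℤ × ZMod 545`. -/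
structure Good (G : SimpleGraph (Fin 7)) (a : Fin 7 → ℕ) : Prop where
  ker : ∀ D, D ∈ Principal G ↔ degSum D = 0 ∧ phi a D = 0
  last : a 6 = 0
  unit : ∃ v, ∃ u : ℕ, ((u * a v : ℕ) : ZMod 545) = 1

theorem degSum_add (D E : Fin 7 → ℤ) : degSum (D + E) = degSum D + degSum E := by
  simp [degSum, Finset.sum_add_distrib]

theorem degSum_sub (D E : Fin 7 → ℤ) : degSum (D - E) = degSum D - degSum E := by
  simp [degSum, Finset.sum_sub_distrib]

theorem degSum_single (v : Fin 7) (k : ℤ) : degSum (Pi.single v k) = k := by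
  simp [degSum]

theorem phi_single (a : Fin 7 → ℕ) (v : Fin 7) (k : ℤ) :
    phi a (Pi.single v k) = (k : ZMod 545) * (a v : ZMod 545) := by
  show (∑ w, ((Pi.single v k : Fin 7 → ℤ) w : ZMod 545) * (a w : ZMod 545)) = _
  rw [Finset.sum_eq_single v]
  · simp
  · intro b _ hb
    simp [Pi.single_eq_of_ne hb]
  · simp

theorem Good.exists_class {G : SimpleGraph (Fin 7)} {a : Fin 7 → ℕ} (h : Good G a)
    (d : ℤ) (s : ZMod 545) : ∃ D, degSum D = d ∧ phi a D = s := by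
  obtain ⟨v, u, hu⟩ := h.unit
  have : NeZero 545 := ⟨by norm_num⟩
  refine ⟨Pi.single v ((s.val * u : ℕ) : ℤ) + Pi.single 6 (d - ((s.val * u : ℕ) : ℤ)), ?_, ?_⟩
  · rw [degSum_add, degSum_single, degSum_single]; ring
  · rw [map_add, phi_single, phi_single, h.last]
    push_cast at hu ⊢
    rw [mul_assoc, hu]
    simp

theorem Good.jac {G : SimpleGraph (Fin 7)} {a : Fin 7 → ℕ} (h : Good G a) :
    Nonempty (Jac G ≃+ ZMod 545) := by
  let f : Deg0 (Fin 7) →+ ZMod 545 := (phi a).comp (Deg0 (Fin 7)).subtype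
  have hf : Function.Surjective f := by
    intro s
    obtain ⟨D, hD, hs⟩ := h.exists_class 0 s
    exact ⟨⟨D, hD⟩, hs⟩
  have hk : (Principal G).addSubgroupOf (Deg0 (Fin 7)) = f.ker := by
    ext ⟨D, hD⟩
    rw [AddSubgroup.mem_addSubgroupOf, AddMonoidHom.mem_ker]
    show D ∈ Principal G ↔ phi a D = 0
    rw [h.ker]
    exact ⟨fun h => h.2, fun h => ⟨hD, h⟩⟩
  exact ⟨(QuotientAddGroup.quotientAddEquivOfEq hk).trans
    (QuotientAddGroup.quotientKerEquivOfSurjective f hf)⟩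

/-- Classes of effective divisors of degree `m`. -/
def W (a : Fin 7 → ℕ) (m : ℤ) : Set (ZMod 545) :=
  {s | ∃ E, Effective E ∧ degSum E = m ∧ phi a E = s}

theorem W_neg (a : Fin 7 → ℕ) {m : ℤ} (hm : m < 0) (s : ZMod 545) : s ∉ W a m := by
  rintro ⟨E, hE, hd, -⟩
  have : 0 ≤ degSum E := Finset.sum_nonneg fun v _ => hE v
  omega

theorem W_zero (a : Fin 7 → ℕ) : W a 0 = {0} := by
  ext s
  constructor
  · rintro ⟨E, hE, hd, rfl⟩
    have : E = 0 := by
      funext v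
      exact (Finset.sum_eq_zero_iff_of_nonneg fun v _ => hE v).1 hd v (Finset.mem_univ v)
    rw [this, map_zero]; rfl
  · rintro rfl
    exact ⟨0, fun v => le_rfl, by simp [degSum], map_zero _⟩

theorem W_add (a : Fin 7 → ℕ) {m : ℤ} {s : ZMod 545} (hs : s ∈ W a m) (v : Fin 7) :
    s + (a v : ZMod 545) ∈ W a (m + 1) := by
  obtain ⟨E, hE, hd, rfl⟩ := hs
  refine ⟨E + Pi.single v 1, ?_, ?_, ?_⟩
  · intro w
    have := hE w
    have h2 : 0 ≤ (Pi.single v 1 : Fin 7 → ℤ) w := by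
      by_cases hw : w = v
      · subst hw; simp
      · simp [Pi.single_eq_of_ne hw]
    simp only [Pi.add_apply]; omega
  · rw [degSum_add, degSum_single, hd]
  · rw [map_add, phi_single]; simp

theorem W_succ (a : Fin 7 → ℕ) {m : ℤ} (hm : 0 ≤ m) :
    W a (m + 1) = {s | ∃ v, s - (a v : ZMod 545) ∈ W a m} := by
  ext s
  constructor
  · rintro ⟨E, hE, hd, rfl⟩
    have : ∃ v, 1 ≤ E v := by
      by_contra hcon
      push Not at hcon
      have : degSum E ≤ 0 := Finset.sum_nonpos fun v _ => by have := hcon v; omega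
      omega
    obtain ⟨v, hv⟩ := this
    refine ⟨v, E - Pi.single v 1, ?_, ?_, ?_⟩
    · intro w
      have := hE w
      by_cases hw : w = v
      · subst hw; simp; omega
      · simpa [Pi.single_eq_of_ne hw] using this
    · rw [degSum_sub, degSum_single, hd]; ring
    · rw [map_sub, phi_single]; simp
  · rintro ⟨v, hv⟩
    simpa using W_add a hv v

theorem W_nonempty (a : Fin 7 → ℕ) {m : ℤ} (hm : 0 ≤ m) : (W a m).Nonempty := by
  refine ⟨_, Pi.single 0 m, ?_, degSum_single _ _, rfl⟩
  intro w
  by_cases hw : w = 0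
  · subst hw; simpa using hm
  · simp [Pi.single_eq_of_ne hw]

theorem Good.winnable {G : SimpleGraph (Fin 7)} {a : Fin 7 → ℕ} (h : Good G a)
    (D : Fin 7 → ℤ) : Winnable G D ↔ phi a D ∈ W a (degSum D) := by
  constructor
  · rintro ⟨E, hE, hl⟩
    obtain ⟨h1, h2⟩ := (h.ker _).1 hl
    rw [degSum_sub] at h1
    rw [map_sub] at h2
    exact ⟨E, hE, by omega, (sub_eq_zero.1 h2).symm⟩
  · rintro ⟨E, hE, hd, hp⟩
    exact ⟨E, hE, (h.ker _).2 ⟨by rw [degSum_sub]; omega, by rw [map_sub, hp, sub_self]⟩⟩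

/-- The class of degree `d` and Jacobian part `s` has rank at least `r`. -/
def Q (a : Fin 7 → ℕ) (d r : ℤ) (s : ZMod 545) : Prop :=
  r = -1 ∨ (0 ≤ r ∧ ∀ e ∈ W a r, s - e ∈ W a (d - r))

theorem Q_down (a : Fin 7 → ℕ) {d r : ℤ} {s : ZMod 545} (hr : -1 ≤ r)
    (hq : Q a d (r + 1) s) : Q a d r s := by
  rcases hr.eq_or_lt with rfl | hr
  · exact Or.inl rfl
  · rcases hq with hq | ⟨-, hq⟩
    · omega
    · refine Or.inr ⟨by omega, fun e he => ?_⟩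
      have := W_add a (hq _ (W_add a he 0)) 0
      convert this using 1 <;> ring_nf

theorem Q_down_le (a : Fin 7 → ℕ) {d r : ℤ} {s : ZMod 545} (hr : -1 ≤ r) (n : ℕ)
    (hq : Q a d (r + n) s) : Q a d r s := by
  induction n with
  | zero => simpa using hq
  | succ n ih =>
    apply ih
    apply Q_down a (by omega)
    convert hq using 1
    push_cast; ring

theorem Q_bdd (a : Fin 7 → ℕ) {d r : ℤ} {s : ZMod 545} (hq : Q a d r s) :
    r ≤ max d (-1) := by
  rcases hq with hq | ⟨h0, hq⟩
  · omega
  · obtain ⟨e, he⟩ := W_nonempty a h0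
    by_contra hcon
    exact W_neg a (by omega) _ (hq e he)

theorem Good.rank_set {G : SimpleGraph (Fin 7)} {a : Fin 7 → ℕ} (h : Good G a)
    (D : Fin 7 → ℤ) : {r : ℤ | r = -1 ∨ (0 ≤ r ∧
    ∀ E : Fin 7 → ℤ, Effective E → degSum E = r → Winnable G (D - E))} =
    {r | Q a (degSum D) r (phi a D)} := by
  ext r
  simp only [Set.mem_ofPred_eq, Q, h.winnable, degSum_sub, map_sub]
  refine or_congr Iff.rfl (and_congr Iff.rfl ⟨?_, ?_⟩)
  · rintro hh e ⟨E, hE, hd, rfl⟩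
    have := hh E hE hd
    rwa [hd] at this
  · intro hh E hE hd
    have := hh _ ⟨E, hE, hd, rfl⟩
    rwa [hd]

theorem Good.rank_iff {G : SimpleGraph (Fin 7)} {a : Fin 7 → ℕ} (h : Good G a)
    (D : Fin 7 → ℤ) (r : ℤ) : bnRank G D = r ↔
      Q a (degSum D) r (phi a D) ∧ ¬ Q a (degSum D) (r + 1) (phi a D) := by
  have hb : BddAbove {r | Q a (degSum D) r (phi a D)} :=
    ⟨max (degSum D) (-1), fun r hr => Q_bdd a hr⟩
  have hn : {r | Q a (degSum D) r (phi a D)}.Nonempty := ⟨-1, Or.inl rfl⟩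
  unfold bnRank
  rw [h.rank_set]
  constructor
  · rintro rfl
    refine ⟨Int.csSup_mem hn hb, fun hq => ?_⟩
    have := le_csSup hb hq
    omega
  · rintro ⟨h1, h2⟩
    apply le_antisymm
    · apply csSup_le hn
      intro r' hr'
      by_contra hcon
      apply h2
      have h3 : -1 ≤ r := by rcases h1 with h | h <;> omega
      apply Q_down_le a (by omega) (r' - (r + 1)).toNat
      have h4 : r + 1 + ((r' - (r + 1)).toNat : ℤ) = r' := by omega
      rw [h4]
      exact hr'
    · exact le_csSup hb h1

theorem Good.numClasses_eq {G : SimpleGraph (Fin 7)} {a : Fin 7 → ℕ} (h : Good G a)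
    (d r : ℤ) : numClasses G d r = Set.ncard ({s | Q a d r s} \ {s | Q a d (r + 1) s}) := by
  unfold numClasses
  symm
  choose F hF1 hF2 using fun s => h.exists_class d s
  refine Set.ncard_congr (fun s _ => QuotientAddGroup.mk' (Principal G) (F s)) ?_ ?_ ?_
  · rintro s ⟨h1, h2⟩
    refine ⟨F s, rfl, hF1 s, (h.rank_iff _ _).2 ?_⟩
    rw [hF1, hF2]
    exact ⟨h1, h2⟩
  · intro s t _ _ hst
    have : -F s + F t ∈ Principal G := QuotientAddGroup.eq.1 hst
    have := ((h.ker _).1 this).2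
    rw [map_add, map_neg, hF2, hF2] at this
    exact (neg_add_eq_zero.1 this)
  · rintro c ⟨D, rfl, hd, hr⟩
    have := (h.rank_iff _ _).1 hr
    rw [hd] at this
    refine ⟨phi a D, this, ?_⟩
    apply QuotientAddGroup.eq.2
    rw [h.ker]
    constructor
    · have := degSum_sub D (F (phi a D))
      rw [neg_add_eq_sub, this, hd, hF1, sub_self]
    · rw [map_add, map_neg, hF2, neg_add_cancel]

/-! ### Bit masks -/

/-- Apply `f` to `n` after evaluating `n`; this speeds up evaluation in the kernel. -/
def force (n : ℕ) (f : ℕ → ℕ) : ℕ :=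
  match n with
  | 0 => f 0
  | k + 1 => f (k + 1)

theorem force_eq (n : ℕ) (f : ℕ → ℕ) : force n f = f n := by
  cases n <;> rfl

/-- The bits of `M` are the elements of `S`. -/
def Rep (M : ℕ) (S : Set (ZMod 545)) : Prop :=
  ∀ i, M.testBit i = true ↔ i < 545 ∧ (i : ZMod 545) ∈ S

theorem Rep.iff {M : ℕ} {S : Set (ZMod 545)} (h : Rep M S) (i : ℕ) :
    M.testBit i = true ↔ i < 545 ∧ (i : ZMod 545) ∈ S := h i

/-- Cyclic rotation of a mask. -/
def rot (M e : ℕ) : ℕ := ((M <<< e) ||| (M >>> (545 - e))) % 2 ^ 545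

theorem Rep.rot {M : ℕ} {S : Set (ZMod 545)} (h : Rep M S) {e : ℕ} (he : e < 545) :
    Rep (rot M e) {s | s - (e : ZMod 545) ∈ S} := by
  intro i
  unfold BNGraph.rot
  rw [Nat.testBit_mod_two_pow, Nat.testBit_or, Nat.testBit_shiftLeft, Nat.testBit_shiftRight]
  simp only [Bool.and_eq_true, Bool.or_eq_true, decide_eq_true_eq, h.iff, Set.mem_ofPred_eq]
  refine and_congr_right fun hi => ?_
  by_cases hei : e ≤ i
  · rw [Nat.cast_sub hei]
    constructor
    · rintro (h | h)
      · exact h.2.2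
      · omega
    · intro h
      exact Or.inl ⟨hei, by omega, h⟩
  · have h545 : ((545 : ℕ) : ZMod 545) = 0 := ZMod.natCast_self 545
    have : ((545 - e + i : ℕ) : ZMod 545) = (i : ZMod 545) - e := by
      rw [Nat.cast_add, Nat.cast_sub he.le, h545]; ring
    rw [this]
    constructor
    · rintro (h | h)
      · exact absurd h.1 hei
      · exact h.2
    · intro h
      exact Or.inr ⟨by omega, h⟩

theorem Rep.or {M N : ℕ} {S T : Set (ZMod 545)} (h : Rep M S) (k : Rep N T) :
    Rep (M ||| N) (S ∪ T) := by
  intro i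
  rw [Nat.testBit_or, Bool.or_eq_true, h, k, Set.mem_union]
  tauto

theorem Rep.and {M N : ℕ} {S T : Set (ZMod 545)} (h : Rep M S) (k : Rep N T) :
    Rep (M &&& N) (S ∩ T) := by
  intro i
  rw [Nat.testBit_and, Bool.and_eq_true, h, k, Set.mem_inter_iff]
  tauto

theorem Rep.full : Rep (2 ^ 545 - 1) Set.univ := by
  intro i
  rw [Nat.testBit_two_pow_sub_one]
  simp

theorem Rep.congr {M : ℕ} {S T : Set (ZMod 545)} (h : Rep M S) (e : S = T) : Rep M T := e ▸ h

/-- Masks of the sets `W a m`. -/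
def mask (a : Fin 7 → ℕ) : ℕ → ℕ
  | 0 => 1
  | m + 1 => rot (mask a m) (a 0) ||| rot (mask a m) (a 1) ||| rot (mask a m) (a 2) |||
      rot (mask a m) (a 3) ||| rot (mask a m) (a 4) ||| rot (mask a m) (a 5) |||
      rot (mask a m) (a 6)

theorem mask_rep (a : Fin 7 → ℕ) (ha : ∀ v, a v < 545) (m : ℕ) : Rep (mask a m) (W a m) := by
  induction m with
  | zero =>
    intro i
    rw [Nat.cast_zero, W_zero, mask, Nat.testBit_one_eq_true_iff_self_eq_zero]
    constructor
    · rintro rfl; simp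
    · rintro ⟨h1, h2⟩
      have h3 := (ZMod.natCast_eq_zero_iff i 545).1 h2
      exact Nat.eq_zero_of_dvd_of_lt h3 h1
  | succ m ih =>
    rw [mask]
    refine ((((((((ih.rot (ha 0)).or (ih.rot (ha 1))).or (ih.rot (ha 2))).or
      (ih.rot (ha 3))).or (ih.rot (ha 4))).or (ih.rot (ha 5))).or (ih.rot (ha 6)))).congr ?_
    rw [Nat.cast_succ, W_succ a (Int.natCast_nonneg m)]
    ext s
    simp only [Set.mem_union, Set.mem_ofPred_eq, Fin.exists_fin_succ, Fin.exists_fin_zero]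
    simp [or_assoc]

/-- `M` has no bits in `[lo, lo + 2 ^ k)`. -/
def noBits (M k lo : ℕ) : Bool := Nat.beq (Nat.mod (Nat.shiftRight M lo) (Nat.pow 2 (Nat.pow 2 k))) 0

theorem noBits_spec {M k lo : ℕ} (h : noBits M k lo = true) {i : ℕ} (h1 : lo ≤ i)
    (h2 : i < lo + 2 ^ k) : M.testBit i = false := by
  have h3 : (M >>> lo) % 2 ^ (2 ^ k) = 0 := Nat.eq_of_beq_eq_true h
  have h4 : ((M >>> lo) % 2 ^ (2 ^ k)).testBit (i - lo) = false := by
    rw [h3, Nat.zero_testBit]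
  rw [Nat.testBit_mod_two_pow, Nat.testBit_shiftRight] at h4
  have h5 : i - lo < 2 ^ k := by omega
  rw [show lo + (i - lo) = i by omega] at h4
  simpa [h5] using h4

/-- Mask of the intersection of the rotations of `Mm` by the elements of `Mr` in
`[lo, lo + 2 ^ k)`, by bisection. -/
def inter (Mr Mm : ℕ) : ℕ → ℕ → ℕ
  | 0, lo => bif Mr.testBit lo then rot Mm lo else 2 ^ 545 - 1
  | k + 1, lo => bif noBits Mr (k + 1) lo then 2 ^ 545 - 1 else
      inter Mr Mm k lo &&& force (lo + 2 ^ k) (inter Mr Mm k)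

theorem inter_rep {Mr Mm : ℕ} {R S : Set (ZMod 545)} (hr : Rep Mr R) (hm : Rep Mm S) (k : ℕ)
    (lo : ℕ) : Rep (inter Mr Mm k lo)
      {s | ∀ i, lo ≤ i → i < lo + 2 ^ k → i < 545 → (i : ZMod 545) ∈ R →
        s - (i : ZMod 545) ∈ S} := by
  induction k generalizing lo with
  | zero =>
    rw [inter]
    by_cases hb : Mr.testBit lo = true
    · rw [hb, cond_true]
      obtain ⟨h1, h2⟩ := (hr lo).1 hb
      refine (hm.rot h1).congr ?_
      ext s
      simp only [Set.mem_ofPred_eq]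
      constructor
      · intro h i hi hi' _ _
        obtain rfl : i = lo := by omega
        exact h
      · intro h
        exact h lo le_rfl (by omega) h1 h2
    · have hb' : ¬ (lo < 545 ∧ (lo : ZMod 545) ∈ R) := fun h => hb ((hr lo).2 h)
      rw [Bool.not_eq_true] at hb
      rw [hb, cond_false]
      refine Rep.full.congr (Set.eq_univ_of_forall ?_).symm
      intro s i hi hi' h5 hR
      obtain rfl : i = lo := by omega
      exact absurd ⟨h5, hR⟩ hb'
  | succ k ih =>
    rw [inter]
    by_cases hz : noBits Mr (k + 1) lo = true
    · rw [hz, cond_true]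
      refine Rep.full.congr (Set.eq_univ_of_forall ?_).symm
      intro s i hi hi' h5 hR
      have := noBits_spec hz hi hi'
      rw [(hr i).2 ⟨h5, hR⟩] at this
      simp at this
    rw [Bool.not_eq_true] at hz
    rw [hz, cond_false, force_eq]
    refine ((ih lo).and (ih (lo + 2 ^ k))).congr ?_
    have hp : 2 ^ (k + 1) = 2 ^ k + 2 ^ k := by rw [pow_succ]; ring
    ext s
    simp only [Set.mem_inter_iff, Set.mem_ofPred_eq]
    constructor
    · rintro ⟨h1, h2⟩ i hi hi' h5 hR
      by_cases hlt : i < lo + 2 ^ k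
      · exact h1 i hi hlt h5 hR
      · exact h2 i (by omega) (by omega) h5 hR
    · intro h
      exact ⟨fun i hi hi' => h i hi (by omega), fun i hi hi' => h i (by omega) (by omega)⟩

theorem inter_rep_full {Mr Mm : ℕ} {R S : Set (ZMod 545)} (hr : Rep Mr R) (hm : Rep Mm S) :
    Rep (inter Mr Mm 10 0) {s | ∀ e ∈ R, s - e ∈ S} := by
  refine (inter_rep hr hm 10 0).congr ?_
  ext s
  simp only [Set.mem_ofPred_eq]
  have : NeZero 545 := ⟨by norm_num⟩
  constructor
  · intro h e he
    have hlt := ZMod.val_lt e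
    have := h e.val (by omega) (by omega) hlt
    rw [ZMod.natCast_zmod_val] at this
    exact this he
  · intro h i _ _ _ hR
    exact h _ hR

/-- Number of bits of `M` in `[lo, lo + 2 ^ k)`, by bisection. -/
def popc (M : ℕ) : ℕ → ℕ → ℕ
  | 0, lo => (M.testBit lo).toNat
  | k + 1, lo => bif noBits M (k + 1) lo then 0 else
      popc M k lo + force (lo + 2 ^ k) (popc M k)

theorem popc_eq (M k lo : ℕ) :
    popc M k lo = ((Finset.Ico lo (lo + 2 ^ k)).filter (fun i => M.testBit i)).card := by
  induction k generalizing lo with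
  | zero =>
    have : Finset.Ico lo (lo + 2 ^ 0) = {lo} := by
      ext i
      simp only [Finset.mem_Ico, Finset.mem_singleton]
      omega
    rw [popc, this, Finset.filter_singleton]
    cases hb : M.testBit lo <;> simp
  | succ k ih =>
    have hp : 2 ^ (k + 1) = 2 ^ k + 2 ^ k := by rw [pow_succ]; ring
    rw [popc]
    by_cases hz : noBits M (k + 1) lo = true
    · rw [hz, cond_true, eq_comm, Finset.card_eq_zero, Finset.filter_eq_empty_iff]
      intro i hi
      rw [Finset.mem_Ico] at hi
      rw [noBits_spec hz hi.1 hi.2]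
      simp
    rw [Bool.not_eq_true] at hz
    rw [hz, cond_false, force_eq, ih, ih, hp, ← add_assoc,
      ← Finset.Ico_union_Ico_eq_Ico (Nat.le_add_right lo (2 ^ k))
        (Nat.le_add_right (lo + 2 ^ k) (2 ^ k)), Finset.filter_union, Finset.card_union_of_disjoint]
    exact Finset.disjoint_filter_filter (Finset.Ico_disjoint_Ico_consecutive _ _ _)

theorem Rep.ncard {M : ℕ} {S : Set (ZMod 545)} (h : Rep M S) : S.ncard = popc M 10 0 := by
  have : NeZero 545 := ⟨by norm_num⟩
  rw [popc_eq, ← Set.ncard_coe_finset]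
  refine Set.ncard_congr (fun s _ => s.val) ?_ ?_ ?_
  · intro s hs
    have := ZMod.val_lt s
    simp only [Finset.coe_filter, Finset.mem_Ico, Set.mem_ofPred_eq, h.iff]
    exact ⟨by omega, this, by rwa [ZMod.natCast_zmod_val]⟩
  · intro s t _ _ hst
    exact ZMod.val_injective _ hst
  · intro i hi
    simp only [Finset.coe_filter, Finset.mem_Ico, Set.mem_ofPred_eq, h.iff] at hi
    exact ⟨i, hi.2.2, ZMod.val_cast_of_lt hi.2.1⟩

/-! ### The zeta function -/

theorem W_univ {a : Fin 7 → ℕ} (h7 : W a 7 = Set.univ) (n : ℕ) :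
    W a (7 + n) = Set.univ := by
  induction n with
  | zero => simpa using h7
  | succ n ih =>
    apply Set.eq_univ_of_forall
    intro s
    have : s - (a 0 : ZMod 545) ∈ W a (7 + n) := by rw [ih]; trivial
    have := W_add a this 0
    rw [sub_add_cancel] at this
    rwa [Nat.cast_succ, ← add_assoc]

theorem Q_count {a b : Fin 7 → ℕ} (ha : ∀ v, a v < 545) (hb : ∀ v, b v < 545)
    (ha7 : popc (mask a 7) 10 0 = 545) (hb7 : popc (mask b 7) 10 0 = 545)
    (ha6 : ∀ m < 7, popc (mask a m) 10 0 ≠ 545) (hb6 : ∀ m < 7, popc (mask b m) 10 0 ≠ 545)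
    (hab : ∀ m < 7, ∀ r < 7, popc (inter (mask a r) (mask a m) 10 0) 10 0 =
      popc (inter (mask b r) (mask b m) 10 0) 10 0) (d r : ℤ) :
    Set.ncard {s | Q a d r s} = Set.ncard {s | Q b d r s} := by
  have : NeZero 545 := ⟨by norm_num⟩
  have key : ∀ a : Fin 7 → ℕ, (∀ v, a v < 545) → popc (mask a 7) 10 0 = 545 →
      (∀ m < 7, popc (mask a m) 10 0 ≠ 545) →
      (∀ m : ℤ, 7 ≤ m → W a m = Set.univ) ∧ (∀ m : ℤ, m < 7 → ∃ s, s ∉ W a m) := by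
    intro a ha ha7 ha6
    constructor
    · intro m hm
      have h7 : W a 7 = Set.univ := by
        have := (mask_rep a ha 7).ncard
        rw [ha7] at this
        apply Set.eq_of_subset_of_ncard_le (Set.subset_univ _)
        rw [Set.ncard_univ, Nat.card_zmod]
        exact this.ge
      have := W_univ h7 (m - 7).toNat
      rwa [show (7 : ℤ) + ((m - 7).toNat : ℤ) = m by omega] at this
    · intro m hm
      by_cases h0 : m < 0
      · exact ⟨0, W_neg a h0 0⟩
      · obtain ⟨k, rfl⟩ := Int.eq_ofNat_of_zero_le (not_lt.1 h0)
        by_contra hcon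
        push Not at hcon
        apply ha6 k (by omega)
        rw [← (mask_rep a ha k).ncard, Set.eq_univ_of_forall hcon, Set.ncard_univ, Nat.card_zmod]
  obtain ⟨ua, na⟩ := key a ha ha7 ha6
  obtain ⟨ub, nb⟩ := key b hb hb7 hb6
  by_cases h1 : r = -1
  · simp [Q, h1]
  by_cases h0 : 0 ≤ r
  swap
  · simp [Q, h1, h0]
  simp only [Q, h1, h0, false_or, true_and]
  by_cases hd : 7 ≤ d - r
  · rw [ua _ hd, ub _ hd]; simp
  have empty : ∀ a : Fin 7 → ℕ, (∀ s, (∀ e ∈ W a r, s - e ∈ W a (d - r)) → False) →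
      Set.ncard {s | ∀ e ∈ W a r, s - e ∈ W a (d - r)} = 0 := by
    intro a h
    have h' : {s | ∀ e ∈ W a r, s - e ∈ W a (d - r)} = ∅ := Set.eq_empty_of_forall_notMem h
    rw [h', Set.ncard_empty]
  by_cases hr : 7 ≤ r
  · rw [empty a, empty b]
    · intro s hs
      obtain ⟨t, ht⟩ := nb (d - r) (by omega)
      apply ht
      have := hs (s - t) (by rw [ub r hr]; trivial)
      simpa using this
    · intro s hs
      obtain ⟨t, ht⟩ := na (d - r) (by omega)
      apply ht
      have := hs (s - t) (by rw [ua r hr]; trivial)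
      simpa using this
  by_cases hn : d - r < 0
  · rw [empty a, empty b]
    · intro s hs
      obtain ⟨t, ht⟩ := W_nonempty b h0
      exact W_neg b hn _ (hs t ht)
    · intro s hs
      obtain ⟨t, ht⟩ := W_nonempty a h0
      exact W_neg a hn _ (hs t ht)
  obtain ⟨k, hk⟩ := Int.eq_ofNat_of_zero_le (not_lt.1 hn)
  obtain ⟨l, rfl⟩ := Int.eq_ofNat_of_zero_le h0
  rw [hk]
  rw [(inter_rep_full (mask_rep a ha l) (mask_rep a ha k)).ncard,
    (inter_rep_full (mask_rep b hb l) (mask_rep b hb k)).ncard]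
  exact hab k (by omega) l (by omega)

theorem sameZeta_of {G G' : SimpleGraph (Fin 7)} {a b : Fin 7 → ℕ} (hG : Good G a)
    (hG' : Good G' b)
    (hab : ∀ d r : ℤ, Set.ncard {s | Q a d r s} = Set.ncard {s | Q b d r s}) :
    SameZeta G G' := by
  have : NeZero 545 := ⟨by norm_num⟩
  intro d r
  rw [hG.numClasses_eq, hG'.numClasses_eq]
  by_cases hr : -1 ≤ r
  · have sub : ∀ a : Fin 7 → ℕ, {s | Q a d (r + 1) s} ⊆ {s | Q a d r s} :=
      fun a s hs => Q_down a hr hs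
    rw [Set.ncard_sdiff (sub a) (Set.toFinite _), Set.ncard_sdiff (sub b) (Set.toFinite _),
      hab, hab]
  · have : ∀ a : Fin 7 → ℕ, {s | Q a d r s} = ∅ := by
      intro a
      apply Set.eq_empty_of_forall_notMem
      rintro s (h | h) <;> omega
    rw [this, this]
    simp

/-! ### The Tutte polynomial at `(3, 2)` -/

theorem card_colorings (A : Finset (Sym2 (Fin 7))) :
    2 ^ numComponents (Fin 7) (A : Set (Sym2 (Fin 7))) =
      ((Finset.univ : Finset (Fin 7 → Bool)).filter
        (fun f => ∀ e ∈ A, (e.map f).IsDiag)).card := by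
  unfold numComponents
  set H := SimpleGraph.fromEdgeSet (A : Set (Sym2 (Fin 7)))
  have : Fintype H.ConnectedComponent := Fintype.ofFinite _
  rw [← Fintype.card_subtype, Nat.card_eq_fintype_card]
  rw [← Fintype.card_bool, ← Fintype.card_fun]
  apply Fintype.card_congr
  refine ⟨fun g => ⟨fun v => g (H.connectedComponentMk v), ?_⟩,
    fun f => fun c => SimpleGraph.ConnectedComponent.lift f.1 ?_ c, ?_, ?_⟩
  · intro e
    induction e with
    | h x y =>
      intro he
      rw [Sym2.map_mk, Sym2.mk_isDiag_iff]
      by_cases hxy : x = y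
      · rw [hxy]
      · have : H.Adj x y := by
          rw [SimpleGraph.fromEdgeSet_adj]
          exact ⟨he, hxy⟩
        rw [SimpleGraph.ConnectedComponent.sound this.reachable]
  · intro v w p _
    induction p with
    | nil => rfl
    | cons h p ih =>
      rename_i q
      refine Eq.trans ?_ (ih q.of_cons)
      rw [SimpleGraph.fromEdgeSet_adj] at h
      have := f.2 _ h.1
      rwa [Sym2.map_mk, Sym2.mk_isDiag_iff] at this
  · intro g
    funext c
    induction c using SimpleGraph.ConnectedComponent.ind with
    | h v => rfl
  · intro f
    rfl

theorem tutte_eval (G : SimpleGraph (Fin 7)) (hG : G.Connected) :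
    2 * MvPolynomial.eval (![3, 2] : Fin 2 → ℤ) (tutte G) =
      ((∑ f : Fin 7 → Bool, 2 ^ (G.edgeFinset.filter (fun e => (e.map f).IsDiag)).card : ℕ) : ℤ) := by
  have hE : numComponents (Fin 7) G.edgeSet = 1 := by
    unfold numComponents
    rw [SimpleGraph.fromEdgeSet_edgeSet]
    have := hG.preconnected.subsingleton_connectedComponent
    have : Nonempty G.ConnectedComponent := ⟨G.connectedComponentMk 0⟩
    exact Nat.card_of_subsingleton (G.connectedComponentMk 0)
  have h1 : ∀ A : Finset (Sym2 (Fin 7)), 1 ≤ numComponents (Fin 7) (A : Set (Sym2 (Fin 7))) := by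
    intro A
    unfold numComponents
    have : Nonempty (SimpleGraph.fromEdgeSet (A : Set (Sym2 (Fin 7)))).ConnectedComponent :=
      ⟨SimpleGraph.connectedComponentMk _ 0⟩
    exact Nat.card_pos
  have h2 : 2 * MvPolynomial.eval (![3, 2] : Fin 2 → ℤ) (tutte G) =
      ((∑ A ∈ G.edgeFinset.powerset, 2 ^ numComponents (Fin 7) (A : Set (Sym2 (Fin 7))) : ℕ) : ℤ) := by
    unfold tutte
    rw [map_sum, Finset.mul_sum]
    push_cast
    apply Finset.sum_congr rfl
    intro A _
    obtain ⟨k, hk⟩ := Nat.exists_eq_add_of_le (h1 A)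
    rw [hE, hk]
    simp [pow_add]
  rw [h2]
  refine congrArg Nat.cast ?_
  simp_rw [card_colorings, Finset.card_filter]
  rw [Finset.sum_comm]
  apply Finset.sum_congr rfl
  intro f _
  rw [← Finset.card_filter, ← Finset.card_filter, ← Finset.card_powerset]
  congr 1
  ext A
  simp only [Finset.mem_filter, Finset.mem_powerset, Finset.subset_iff]
  constructor
  · rintro ⟨h1, h2⟩ e he
    exact ⟨h1 he, h2 e he⟩
  · intro h
    exact ⟨fun e he => (h he).1, fun e he => (h he).2⟩

/-! ### The two graphs -/

/-- Edges of the first graph. -/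
def E1 : Finset (Sym2 (Fin 7)) :=
  {s(0, 1), s(0, 2), s(0, 3), s(0, 4), s(0, 5), s(1, 2), s(1, 3), s(1, 4), s(1, 6), s(2, 3),
    s(2, 5), s(3, 6), s(5, 6)}

/-- Edges of the second graph. -/
def E2 : Finset (Sym2 (Fin 7)) :=
  {s(0, 1), s(0, 2), s(0, 3), s(0, 4), s(0, 5), s(1, 2), s(1, 3), s(1, 4), s(2, 3), s(2, 4),
    s(3, 5), s(4, 6), s(5, 6)}

/-- The graph with a given finite edge set. -/
def gr (E : Finset (Sym2 (Fin 7))) : SimpleGraph (Fin 7) := SimpleGraph.fromEdgeSet (E : Set _)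

theorem gr_adj (E : Finset (Sym2 (Fin 7))) (v w : Fin 7) :
    (gr E).Adj v w ↔ s(v, w) ∈ E ∧ v ≠ w := by
  simp [gr]

theorem gr_edgeSet (E : Finset (Sym2 (Fin 7))) (hE : ∀ e ∈ E, ¬ e.IsDiag) :
    (gr E).edgeSet = (E : Set (Sym2 (Fin 7))) := by
  unfold gr
  rw [SimpleGraph.edgeSet_fromEdgeSet]
  ext e
  simp only [Set.mem_sdiff, Finset.mem_coe]
  exact ⟨fun h => h.1, fun h => ⟨h, hE e h⟩⟩

theorem lap_gr (E : Finset (Sym2 (Fin 7))) (f : Fin 7 → ℤ) (v : Fin 7) :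
    lap (gr E) f v = ∑ w, if s(v, w) ∈ E ∧ v ≠ w then f v - f w else 0 := by
  show ((gr E).degree v : ℤ) * f v - ∑ w ∈ (gr E).neighborFinset v, f w = _
  rw [← SimpleGraph.card_neighborFinset_eq_degree, ← nsmul_eq_mul, ← Finset.sum_const,
    ← Finset.sum_sub_distrib, ← Finset.sum_filter]
  apply Finset.sum_congr _ fun _ _ => rfl
  ext w
  simp [gr_adj]

theorem phi_eq_zero (a : Fin 7 → ℕ) (D : Fin 7 → ℤ) :
    phi a D = 0 ↔ (545 : ℤ) ∣ ∑ v, D v * a v := by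
  have h := ZMod.intCast_zmod_eq_zero_iff_dvd (∑ v, D v * (a v : ℤ)) 545
  push_cast at h
  exact h

/-- Vertex classes of the first graph. -/
def a1 : Fin 7 → ℕ := ![311, 191, 214, 179, 251, 175, 0]

/-- Vertex classes of the second graph. -/
def a2 : Fin 7 → ℕ := ![355, 487, 378, 365, 305, 240, 0]

theorem lap1 (f : Fin 7 → ℤ) : lap (gr E1) f =
    ![5 * f 0 - f 1 - f 2 - f 3 - f 4 - f 5,
      5 * f 1 - f 0 - f 2 - f 3 - f 4 - f 6,
      4 * f 2 - f 0 - f 1 - f 3 - f 5,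
      4 * f 3 - f 0 - f 1 - f 2 - f 6,
      2 * f 4 - f 0 - f 1,
      3 * f 5 - f 0 - f 2 - f 6,
      3 * f 6 - f 1 - f 3 - f 5] := by
  funext v
  rw [lap_gr, Fin.sum_univ_seven]
  fin_cases v <;> simp [E1] <;> ring

theorem lap2 (f : Fin 7 → ℤ) : lap (gr E2) f =
    ![5 * f 0 - f 1 - f 2 - f 3 - f 4 - f 5,
      4 * f 1 - f 0 - f 2 - f 3 - f 4,
      4 * f 2 - f 0 - f 1 - f 3 - f 4,
      4 * f 3 - f 0 - f 1 - f 2 - f 5,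
      4 * f 4 - f 0 - f 1 - f 2 - f 6,
      3 * f 5 - f 0 - f 3 - f 6,
      2 * f 6 - f 4 - f 5] := by
  funext v
  rw [lap_gr, Fin.sum_univ_seven]
  fin_cases v <;> simp [E2] <;> ring

theorem good1 : Good (gr E1) a1 := by
  refine ⟨fun D => ?_, rfl, 0, 361, by decide +kernel⟩
  rw [phi_eq_zero]
  constructor
  · rintro ⟨f, rfl⟩
    rw [lap1]
    constructor
    · simp [degSum, Fin.sum_univ_seven]; ring
    · refine ⟨f 0 - f 6, ?_⟩
      simp [Fin.sum_univ_seven, a1]; ring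
  · rintro ⟨h, k, hk⟩
    simp [degSum, Fin.sum_univ_seven, a1] at h hk
    refine ⟨![k,
  (151)*D 0 + (93)*D 1 + (104)*D 2 + (87)*D 3 + (122)*D 4 + (85)*D 5 + (-264)*k,
  (78)*D 0 + (48)*D 1 + (54)*D 2 + (45)*D 3 + (63)*D 4 + (44)*D 5 + (-136)*k,
  (135)*D 0 + (83)*D 1 + (93)*D 2 + (78)*D 3 + (109)*D 4 + (76)*D 5 + (-236)*k,
  (-80)*D 0 + (-49)*D 1 + (-55)*D 2 + (-46)*D 3 + (-64)*D 4 + (-45)*D 5 + (141)*k,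
  (26)*D 0 + (16)*D 1 + (18)*D 2 + (15)*D 3 + (21)*D 4 + (15)*D 5 + (-45)*k, 0], ?_⟩
    rw [lap1]
    funext v
    fin_cases v <;> simp <;> omega

theorem good2 : Good (gr E2) a2 := by
  refine ⟨fun D => ?_, rfl, 1, 498, by decide +kernel⟩
  rw [phi_eq_zero]
  constructor
  · rintro ⟨f, rfl⟩
    rw [lap2]
    constructor
    · simp [degSum, Fin.sum_univ_seven]; ring
    · refine ⟨f 1 - f 6, ?_⟩
      simp [Fin.sum_univ_seven, a2]; ring
  · rintro ⟨h, k, hk⟩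
    simp [degSum, Fin.sum_univ_seven, a2] at h hk
    refine ⟨![
  (-136)*D 0 + (-187)*D 1 + (-145)*D 2 + (-140)*D 3 + (-117)*D 4 + (-92)*D 5 + (210)*k,
  k,
  (-142)*D 0 + (-195)*D 1 + (-151)*D 2 + (-146)*D 3 + (-122)*D 4 + (-96)*D 5 + (219)*k,
  (170)*D 0 + (233)*D 1 + (181)*D 2 + (175)*D 3 + (146)*D 4 + (115)*D 5 + (-260)*k,
  (108)*D 0 + (148)*D 1 + (115)*D 2 + (111)*D 3 + (93)*D 4 + (73)*D 5 + (-165)*k,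
  (-107)*D 0 + (-147)*D 1 + (-114)*D 2 + (-110)*D 3 + (-92)*D 4 + (-72)*D 5 + (165)*k, 0], ?_⟩
    rw [lap2]
    funext v
    fin_cases v <;> simp <;> omega

theorem gr_connected (E : Finset (Sym2 (Fin 7)))
    (h : ∀ v : Fin 7, v = 0 ∨ ∃ w, (w = 0 ∨ (s(0, w) ∈ E ∧ 0 ≠ w)) ∧ s(w, v) ∈ E ∧ w ≠ v) :
    (gr E).Connected := by
  have h0 : ∀ v, (gr E).Reachable 0 v := by
    intro v
    rcases h v with rfl | ⟨w, hw, hv⟩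
    · exact SimpleGraph.Reachable.refl _
    · have h2 : (gr E).Reachable w v := ((gr_adj E w v).2 hv).reachable
      rcases hw with rfl | hw
      · exact h2
      · exact ((gr_adj E 0 w).2 hw).reachable.trans h2
  have : Nonempty (Fin 7) := ⟨0⟩
  exact ⟨fun u v => (h0 u).symm.trans (h0 v)⟩

theorem gr_edgeCount (E : Finset (Sym2 (Fin 7))) (hE : ∀ e ∈ E, ¬ e.IsDiag) :
    edgeCount (gr E) = E.card := by
  unfold edgeCount
  rw [gr_edgeSet E hE, Nat.card_coe_set_eq, Set.ncard_coe_finset]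

theorem gr_tutte (E : Finset (Sym2 (Fin 7))) (hE : ∀ e ∈ E, ¬ e.IsDiag)
    (hc : (gr E).Connected) :
    2 * MvPolynomial.eval (![3, 2] : Fin 2 → ℤ) (tutte (gr E)) =
      ((∑ f : Fin 7 → Bool, 2 ^ (E.filter (fun e => (e.map f).IsDiag)).card : ℕ) : ℤ) := by
  rw [tutte_eval _ hc]
  have : (gr E).edgeFinset = E := by
    apply Finset.coe_injective
    rw [SimpleGraph.coe_edgeFinset, gr_edgeSet E hE]
  rw [this]

theorem potts1 : (∑ f : Fin 7 → Bool, 2 ^ (E1.filter (fun e => (e.map f).IsDiag)).card) = 38304 := by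
  decide +kernel

theorem potts2 : (∑ f : Fin 7 → Bool, 2 ^ (E2.filter (fun e => (e.map f).IsDiag)).card) = 38784 := by
  decide +kernel

/-- Number of classes of degree `m + r` and rank at least `r`. -/
def cnt (a : Fin 7 → ℕ) (m r : ℕ) : ℕ :=
  force (mask a r) fun Mr => force (mask a m) fun Mm => force (inter Mr Mm 10 0) fun M =>
    popc M 10 0

theorem cnt_eq (a : Fin 7 → ℕ) (m r : ℕ) :
    cnt a m r = popc (inter (mask a r) (mask a m) 10 0) 10 0 := by
  simp only [cnt, force_eq]

theorem counts_aux : ∀ m < 7, ∀ r < 7, cnt a1 m r = cnt a2 m r := by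
  decide +kernel

theorem counts : ∀ m < 7, ∀ r < 7, popc (inter (mask a1 r) (mask a1 m) 10 0) 10 0 =
    popc (inter (mask a2 r) (mask a2 m) 10 0) 10 0 := by
  intro m hm r hr
  rw [← cnt_eq, ← cnt_eq]
  exact counts_aux m hm r hr

/-- There are connected simple graphs on 7 vertices with 13 edges (hence of genus 7)
whose Jacobians are both isomorphic to `ℤ/545ℤ` and which have the same two-variable
zeta function, but whose Tutte polynomials are different. -/
theorem exists_genus7_sameZeta_isoJac_differentTutte :
    ∃ G G' : SimpleGraph (Fin 7),
      G.Connected ∧ G'.Connected ∧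
      edgeCount G = 13 ∧ edgeCount G' = 13 ∧
      Nonempty (Jac G ≃+ ZMod 545) ∧
      Nonempty (Jac G' ≃+ ZMod 545) ∧
      SameZeta G G' ∧
      tutte G ≠ tutte G' := by
  have e1 : ∀ e ∈ E1, ¬ e.IsDiag := by decide +kernel
  have e2 : ∀ e ∈ E2, ¬ e.IsDiag := by decide +kernel
  have c1 : (gr E1).Connected := gr_connected E1 (by decide +kernel)
  have c2 : (gr E2).Connected := gr_connected E2 (by decide +kernel)
  refine ⟨gr E1, gr E2, c1, c2, ?_, ?_, good1.jac, good2.jac,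
    sameZeta_of good1 good2 (Q_count (by decide +kernel) (by decide +kernel) (by decide +kernel)
      (by decide +kernel) (by decide +kernel) (by decide +kernel) counts), ?_⟩
  · rw [gr_edgeCount E1 e1]; decide +kernel
  · rw [gr_edgeCount E2 e2]; decide +kernel
  · intro h
    have h1 := gr_tutte E1 e1 c1
    have h2 := gr_tutte E2 e2 c2
    rw [potts1] at h1
    rw [potts2] at h2
    rw [h, h2] at h1
    norm_num at h1

end BNGraph
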